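/- For t ≥ a, let B denote the set of monomials of degree t in S divisible by x_1^a, and let d be smaller than the number of monomials in R_t. Then d_{n,t} = (d+|B|)^{<n−1>} − |B|^{<n−1>}; in particular, d_{n,t} < d^{<n−1>}. -/

import Mathlib

open scoped Classical
open Finset

noncomputable section

/-- The monomials of degree `t` in `n` variables, identified with exponent vectors. -/
def degMon (n t : ℕ) : Finset (Fin n → ℕ) := Finset.Nat.antidiagonalTuple n t

/-- The exponent of `x_1` in a monomial. -/
def x1exp {n : ℕ} (m : Fin n → ℕ) : ℕ := if h : 0 < n then m ⟨0, h⟩ else 0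

/-- `lexLt u v` : `u` is lexicographically smaller than `v` as monomials
(with `x_1 > x_2 > ... > x_n`), i.e. `v > u`. -/
def lexLt {n : ℕ} (u v : Fin n → ℕ) : Prop :=
  ∃ i : Fin n, (∀ j : Fin n, j < i → u j = v j) ∧ u i < v i

/-- `M` is a lexsegment set inside the ground set `G` of monomials. -/
def IsLexSeg {n : ℕ} (G M : Finset (Fin n → ℕ)) : Prop :=
  M ⊆ G ∧ ∀ m ∈ M, ∀ v ∈ G, lexLt m v → v ∈ M

/-- The lexsegment set consisting of the top `d` monomials of `G` in the lex order. -/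
def lexSeg {n : ℕ} (G : Finset (Fin n → ℕ)) (d : ℕ) : Finset (Fin n → ℕ) :=
  G.filter (fun m => (G.filter (fun v => m = v ∨ lexLt m v)).card ≤ d)

/-- `S_1 · M` : all monomials `u * m` with `u` a variable and `m ∈ M`. -/
def S1mul (n : ℕ) (M : Finset (Fin n → ℕ)) : Finset (Fin n → ℕ) :=
  Finset.univ.biUnion (fun i : Fin n => M.image (fun m => m + Pi.single i 1))

/-- `S'_1 · M` : all monomials `x_i * m` with `2 ≤ i ≤ n` and `m ∈ M`. -/
def S1'mul (n : ℕ) (M : Finset (Fin n → ℕ)) : Finset (Fin n → ℕ) :=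
  (Finset.univ.filter (fun i : Fin n => (i : ℕ) ≠ 0)).biUnion
    (fun i => M.image (fun m => m + Pi.single i 1))

/-- `d^{<k>}` : the number of monomials obtained by multiplying each member of the
lexsegment set of `d` monomials of a fixed degree in `k+1` variables by each of the
`k+1` variables.  (We realize it in degree `d`, where the lexsegment set exists;
the number is independent of the chosen degree.  Also `0^{<k>} = 0`.) -/
def growth (d k : ℕ) : ℕ := (S1mul (k + 1) (lexSeg (degMon (k + 1) d) d)).card

/-- The monomials of `R_t` where `R = S/(x_1^a)` : degree-`t` monomials whose
`x_1`-exponent is at most `a - 1`. -/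
def RMon (n a t : ℕ) : Finset (Fin n → ℕ) :=
  (degMon n t).filter (fun m => x1exp m < a)

/-- `R_1 · M` : the monomials of `S_1 · M` not divisible by `x_1^a`. -/
def R1mul (n a : ℕ) (M : Finset (Fin n → ℕ)) : Finset (Fin n → ℕ) :=
  (S1mul n M).filter (fun m => x1exp m < a)

/-- `d_{n,t}` : the size of `R_1 · L` for the lexsegment set `L` of `d` monomials in `R_t`. -/
def dnt (n a t d : ℕ) : ℕ := (R1mul n a (lexSeg (RMon n a t) d)).card

/-- `M^i` : the monomials of `M` divisible by `x_1^i` but not by `x_1^{i+1}`. -/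
def comp {n : ℕ} (M : Finset (Fin n → ℕ)) (i : ℕ) : Finset (Fin n → ℕ) :=
  M.filter (fun m => x1exp m = i)

/-- `I(M)` : the smallest `i` such that `M^i ≠ ∅`. -/
def Imon {n : ℕ} (M : Finset (Fin n → ℕ)) : ℕ := sInf {i | (comp M i).Nonempty}

/-- `M` is Gotzmann in `S_t`. -/
def GotzmannS (n t : ℕ) (M : Finset (Fin n → ℕ)) : Prop :=
  (S1mul n (lexSeg (degMon n t) M.card)).card = (S1mul n M).card

/-- `M` is Gotzmann in `R_t`, `R = S/(x_1^a)`. -/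
def GotzmannR (n a t : ℕ) (M : Finset (Fin n → ℕ)) : Prop :=
  (R1mul n a (lexSeg (RMon n a t) M.card)).card = (R1mul n a M).card

/-- The monomials of degree `t` of `S' = F[x_2,...,x_n]`, viewed inside the `n`
variables as the monomials with `x_1`-exponent `0`. -/
def SpMon (n t : ℕ) : Finset (Fin n → ℕ) :=
  (degMon n t).filter (fun m => x1exp m = 0)

/-- `M` is Gotzmann in `S' = F[x_2,...,x_n]` (in degree `t`). -/
def GotzmannSp (n t : ℕ) (M : Finset (Fin n → ℕ)) : Prop :=
  (S1'mul n (lexSeg (SpMon n t) M.card)).card = (S1'mul n M).card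

/-- Dividing a monomial by the pure power of `x_1` it contains: set the first exponent to `0`. -/
def clearX1 {n : ℕ} (m : Fin n → ℕ) : Fin n → ℕ :=
  fun j => if (j : ℕ) = 0 then 0 else m j

/-- `M^i / x_1` : the monomials `m` of `S'` with `m * x_1^i ∈ M^i` (applied to `M = M^i`). -/
def divX1 {n : ℕ} (M : Finset (Fin n → ℕ)) : Finset (Fin n → ℕ) :=
  M.image clearX1

/-- `u · M` : the monomials `u * m` with `m ∈ M`. -/
def mulMon {n : ℕ} (u : Fin n → ℕ) (M : Finset (Fin n → ℕ)) : Finset (Fin n → ℕ) :=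
  M.image (fun m => u + m)

/-- The set `B` of degree-`t` monomials of `S` divisible by `x_1^a`. -/
def Bset (n a t : ℕ) : Finset (Fin n → ℕ) :=
  (degMon n t).filter (fun m => a ≤ x1exp m)

/-! ### Numerical part -/

theorem num_L1 (f F N E : ℕ → ℕ) (hN1 : ∀ i, 1 ≤ N i)
    (hE : ∀ i, E (i+1) = E i + N (i+1))
    (hF : ∀ i r, r ≤ N (i+1) → F (E i + r) = F (E i) + f r)
    (ha : ∀ x q, f (x+q) ≤ f x + f q) :
    ∀ q i, F (E i) + f q ≤ F (E i + q) := by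
  intro q
  induction q using Nat.strong_induction_on with
  | _ q ih =>
    intro i
    by_cases h : q ≤ N (i+1)
    · rw [hF i q h]
    · obtain ⟨q', rfl⟩ : ∃ q', q = N (i+1) + q' := ⟨q - N (i+1), by omega⟩
      have h1 := ih q' (by have := hN1 (i+1); omega) (i+1)
      have h2 := hF i (N (i+1)) le_rfl
      have h3 := ha (N (i+1)) q'
      rw [← add_assoc, ← hE]
      rw [← hE] at h2
      omega

theorem num_L2 (f F N E : ℕ → ℕ) (hN1 : ∀ i, 1 ≤ N i) (hE0 : E 0 = 1)
    (hE : ∀ i, E (i+1) = E i + N (i+1)) (hF1 : F 1 = f 1 + 1)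
    (hF : ∀ i r, r ≤ N (i+1) → F (E i + r) = F (E i) + f r)
    (ha : ∀ x q, f (x+q) ≤ f x + f q) (q : ℕ) (hq : 0 < q) : f q < F q := by
  obtain ⟨q', rfl⟩ : ∃ q', q = 1 + q' := ⟨q - 1, by omega⟩
  have h1 := num_L1 f F N E hN1 hE hF ha q' 0
  have h2 := ha 1 q'
  rw [hE0] at h1
  omega

theorem num_block (N E : ℕ → ℕ) (hN1 : ∀ i, 1 ≤ N i) (hE0 : E 0 = 1)
    (hE : ∀ i, E (i+1) = E i + N (i+1)) (x : ℕ) (hx : 0 < x) :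
    ∃ i s, x = E i + s ∧ s < N (i+1) := by
  induction x with
  | zero => omega
  | succ x ih =>
    rcases Nat.eq_zero_or_pos x with rfl | h
    · exact ⟨0, 0, by omega, hN1 1⟩
    · obtain ⟨i, s, h1, h2⟩ := ih h
      by_cases h3 : s + 1 < N (i+1)
      · exact ⟨i, s+1, by omega, h3⟩
      · exact ⟨i+1, 0, by rw [hE]; omega, hN1 _⟩

theorem num_L3 (f F N E : ℕ → ℕ) (hN1 : ∀ i, 1 ≤ N i) (hN : Monotone N) (hE0 : E 0 = 1)
    (hE : ∀ i, E (i+1) = E i + N (i+1)) (hF0 : F 0 = 0) (hF1 : F 1 = f 1 + 1)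
    (hF : ∀ i r, r ≤ N (i+1) → F (E i + r) = F (E i) + f r)
    (ha : ∀ x q, f (x+q) ≤ f x + f q)
    (hb : ∀ j u q x, u + q = N j → x + q ≤ N j → f (N j) + f x ≤ f (x+q) + f u)
    (j u q x : ℕ) (hu : u + q = N j) (hx : x + q ≤ E j) :
    F x + f (N j) ≤ F (x+q) + f u := by
  rcases Nat.eq_zero_or_pos q with rfl | hq
  · simp at hu; subst hu; simp
  rcases Nat.eq_zero_or_pos x with rfl | hx0
  · have h1 := num_L2 f F N E hN1 hE0 hE hF1 hF ha q hq
    have h2 := ha u q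
    rw [hu] at h2
    rw [zero_add]
    omega
  obtain ⟨i, s, rfl, hs⟩ := num_block N E hN1 hE0 hE x hx0
  have hEm : Monotone E := monotone_nat_of_le_succ (fun i => by rw [hE]; omega)
  have hij : i + 1 ≤ j := by
    by_contra hc
    have := hEm (show j ≤ i by omega)
    omega
  have hNij := hN hij
  have e1 := hF i s hs.le
  by_cases h : s + q ≤ N (i+1)
  · have h1 := hb j u q s hu (by omega)
    have e2 := hF i (s+q) h
    rw [add_assoc, e1, e2]
    omega
  · obtain ⟨q1, hq1⟩ : ∃ q1, s + q1 = N (i+1) := ⟨N (i+1) - s, by omega⟩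
    obtain ⟨q2, rfl⟩ : ∃ q2, q = q1 + q2 := ⟨q - q1, by omega⟩
    have h1 := num_L1 f F N E hN1 hE hF ha q2 (i+1)
    have h2 := hF i (N (i+1)) le_rfl
    rw [← hE] at h2
    have h3 := hb j (u+q2) q1 s (by omega) (by omega)
    have h4 := ha u q2
    have h5 : E i + s + (q1 + q2) = E (i+1) + q2 := by rw [hE]; omega
    rw [h5]
    rw [hq1] at h3
    omega

theorem num_L4 (f F N E : ℕ → ℕ) (hN1 : ∀ i, 1 ≤ N i) (hN : Monotone N) (hE0 : E 0 = 1)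
    (hE : ∀ i, E (i+1) = E i + N (i+1)) (hF0 : F 0 = 0) (hF1 : F 1 = f 1 + 1) (hf0 : f 0 = 0)
    (hF : ∀ i r, r ≤ N (i+1) → F (E i + r) = F (E i) + f r)
    (ha : ∀ x q, f (x+q) ≤ f x + f q)
    (hb : ∀ j u q x, u + q = N j → x + q ≤ N j → f (N j) + f x ≤ f (x+q) + f u) :
    ∀ j u q x, u + q = E j → x + q ≤ E j → F (E j) + F x ≤ F (x+q) + F u := by
  intro j
  induction j with
  | zero =>
    intro u q x h1 h2
    rw [hE0] at *
    rcases Nat.eq_zero_or_pos q with rfl | hq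
    · obtain rfl : u = 1 := by omega
      simp; omega
    · obtain rfl : q = 1 := by omega
      obtain rfl : u = 0 := by omega
      obtain rfl : x = 0 := by omega
      simp
  | succ j ih =>
    intro u q x h1 h2
    have e1 := hF j (N (j+1)) le_rfl
    rw [← hE] at e1
    by_cases h : q ≤ N (j+1)
    · obtain ⟨u', rfl⟩ : ∃ u', u = E j + u' := ⟨u - E j, by rw [hE] at h1; omega⟩
      have h3 := num_L3 f F N E hN1 hN hE0 hE hF0 hF1 hF ha hb (j+1) u' q x
        (by rw [hE] at h1; omega) h2
      have e2 := hF j u' (by rw [hE] at h1; omega)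
      omega
    · obtain ⟨q', rfl⟩ : ∃ q', q = q' + N (j+1) := ⟨q - N (j+1), by omega⟩
      have h3 := ih u q' x (by rw [hE] at h1; omega) (by rw [hE] at h2; omega)
      have h4 := num_L3 f F N E hN1 hN hE0 hE hF0 hF1 hF ha hb (j+1) 0 (N (j+1)) (x+q')
        (by omega) (by omega)
      rw [← add_assoc]
      omega

theorem num_L5 (f F N E : ℕ → ℕ) (hN1 : ∀ i, 1 ≤ N i) (hN : Monotone N) (hE0 : E 0 = 1)
    (hE : ∀ i, E (i+1) = E i + N (i+1)) (hF0 : F 0 = 0) (hF1 : F 1 = f 1 + 1) (hf0 : f 0 = 0)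
    (hF : ∀ i r, r ≤ N (i+1) → F (E i + r) = F (E i) + f r)
    (ha : ∀ x q, f (x+q) ≤ f x + f q)
    (hb : ∀ j u q x, u + q = N j → x + q ≤ N j → f (N j) + f x ≤ f (x+q) + f u)
    (x q : ℕ) (hx : 0 < x) (hq : 0 < q) : F (x+q) < F x + F q := by
  wlog hqx : q ≤ x generalizing x q
  · have := this q x hq hx (by omega)
    rw [add_comm x q]; omega
  obtain ⟨l, s, h1, h2⟩ := num_block N E hN1 hE0 hE (x+q-1) (by omega)
  have hr : x + q = E l + (s+1) := by omega
  have e1 := hF l (s+1) h2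
  by_cases h : q ≤ s + 1
  · obtain ⟨o, ho⟩ : ∃ o, s + 1 = o + q := ⟨s + 1 - q, by omega⟩
    have e2 := hF l o (by omega)
    have e3 : x = E l + o := by omega
    have h3 := ha o q
    have h4 := num_L2 f F N E hN1 hE0 hE hF1 hF ha q hq
    rw [hr, e1, e3, e2, ho]
    omega
  · obtain ⟨q', rfl⟩ : ∃ q', q = (s+1) + q' := ⟨q - (s+1), by omega⟩
    have h3 := num_L4 f F N E hN1 hN hE0 hE hF0 hF1 hf0 hF ha hb l x q' (s+1)
      (by omega) (by omega)
    have h4 := num_L2 f F N E hN1 hE0 hE hF1 hF ha (s+1) (by omega)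
    rw [hr, e1]
    omega

/-! ### Lex segments -/

theorem lexLt_iff {n : ℕ} (u v : Fin n → ℕ) : lexLt u v ↔ toLex u < toLex v := Iff.rfl

theorem lexLt_irrefl {n : ℕ} (u : Fin n → ℕ) : ¬ lexLt u u := by
  rw [lexLt_iff]; exact lt_irrefl _

theorem lexLt_trans {n : ℕ} {u v w : Fin n → ℕ} (h : lexLt u v) (h' : lexLt v w) :
    lexLt u w := by
  rw [lexLt_iff] at *; exact lt_trans h h'

theorem lexLt_tri {n : ℕ} (u v : Fin n → ℕ) : lexLt u v ∨ u = v ∨ lexLt v u := by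
  rw [lexLt_iff, lexLt_iff]; exact lt_trichotomy (toLex u) (toLex v)

theorem lexSeg_of_isLexSeg {n : ℕ} {G L : Finset (Fin n → ℕ)} (h : IsLexSeg G L) :
    lexSeg G L.card = L := by
  ext m
  simp only [lexSeg, mem_filter]
  constructor
  · rintro ⟨hm, hc⟩
    by_contra hmL
    have hsub : insert m L ⊆ G.filter (fun v => m = v ∨ lexLt m v) := by
      intro v hv
      rw [mem_insert] at hv
      rcases hv with rfl | hv
      · simp [hm]
      · refine mem_filter.2 ⟨h.1 hv, ?_⟩
        rcases lexLt_tri m v with h1 | h1 | h1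
        · exact Or.inr h1
        · exact Or.inl h1
        · exact absurd (h.2 v hv m hm h1) hmL
    have := card_le_card hsub
    rw [card_insert_of_notMem hmL] at this
    omega
  · intro hm
    refine ⟨h.1 hm, card_le_card ?_⟩
    intro v hv
    rw [mem_filter] at hv
    rcases hv.2 with rfl | h1
    · exact hm
    · exact h.2 m hm v hv.1 h1

theorem isLexSeg_lexSeg {n : ℕ} (G : Finset (Fin n → ℕ)) (d : ℕ) : IsLexSeg G (lexSeg G d) := by
  refine ⟨filter_subset _ _, ?_⟩
  intro m hm v hv hmv
  simp only [lexSeg, mem_filter] at hm ⊢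
  refine ⟨hv, le_trans (card_le_card ?_) hm.2⟩
  intro w hw
  rw [mem_filter] at hw ⊢
  refine ⟨hw.1, Or.inr ?_⟩
  rcases hw.2 with rfl | h
  · exact hmv
  · exact lexLt_trans hmv h

theorem exists_lexSeg {n : ℕ} (G : Finset (Fin n → ℕ)) (d : ℕ) (hd : d ≤ G.card) :
    ∃ L, IsLexSeg G L ∧ L.card = d := by
  induction d with
  | zero => exact ⟨∅, ⟨by simp, by simp⟩, rfl⟩
  | succ d ih =>
    obtain ⟨L, hL, hc⟩ := ih (by omega)
    have hne : (G \ L).Nonempty := by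
      rw [← card_pos, card_sdiff_of_subset hL.1]; omega
    obtain ⟨m, hm, hmax⟩ := exists_max_image (G \ L) (fun m => toLex m) hne
    rw [mem_sdiff] at hm
    refine ⟨insert m L, ⟨?_, ?_⟩, by rw [card_insert_of_notMem hm.2, hc]⟩
    · exact insert_subset hm.1 hL.1
    · intro w hw v hv hwv
      rw [mem_insert] at hw ⊢
      by_cases hvL : v ∈ L
      · exact Or.inr hvL
      rcases hw with rfl | hw
      · have := hmax v (mem_sdiff.2 ⟨hv, hvL⟩)
        rw [lexLt_iff] at hwv
        exact absurd hwv (not_lt.2 this)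
      · exact Or.inr (hL.2 w hw v hv hwv)

theorem card_lexSeg {n : ℕ} (G : Finset (Fin n → ℕ)) (d : ℕ) (hd : d ≤ G.card) :
    (lexSeg G d).card = d := by
  obtain ⟨L, hL, rfl⟩ := exists_lexSeg G d hd
  rw [lexSeg_of_isLexSeg hL]

theorem lexSeg_zero {n : ℕ} (G : Finset (Fin n → ℕ)) : lexSeg G 0 = ∅ :=
  card_eq_zero.1 (card_lexSeg G 0 (by omega))

theorem mem_degMon {n t : ℕ} {m : Fin n → ℕ} : m ∈ degMon n t ↔ ∑ i, m i = t := by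
  simp [degMon, Finset.Nat.mem_antidiagonalTuple]

theorem mem_S1mul {n : ℕ} {M : Finset (Fin n → ℕ)} {v : Fin n → ℕ} :
    v ∈ S1mul n M ↔ ∃ i, ∃ m ∈ M, m + Pi.single i 1 = v := by
  simp [S1mul]

theorem x1exp_succ {n : ℕ} (m : Fin (n+1) → ℕ) : x1exp m = m 0 := by
  simp [x1exp]

theorem lexLt_add {n : ℕ} (u v w : Fin n → ℕ) : lexLt (u + w) (v + w) ↔ lexLt u v := by
  simp [lexLt]

/-- multiplication by a fixed monomial commutes with `S1mul`. -/
theorem S1mul_shift {n : ℕ} (M : Finset (Fin n → ℕ)) (w : Fin n → ℕ) :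
    S1mul n (M.image (· + w)) = (S1mul n M).image (· + w) := by
  ext v
  simp only [mem_S1mul, mem_image]
  constructor
  · rintro ⟨i, _, ⟨m, hm, rfl⟩, rfl⟩
    exact ⟨_, ⟨i, m, hm, rfl⟩, by abel⟩
  · rintro ⟨_, ⟨i, m, hm, rfl⟩, rfl⟩
    exact ⟨i, _, ⟨m, hm, rfl⟩, by abel⟩

theorem card_shift {n : ℕ} (M : Finset (Fin n → ℕ)) (w : Fin n → ℕ) :
    (M.image (· + w)).card = M.card :=
  card_image_of_injective _ (add_left_injective w)

theorem sum_single {n : ℕ} (m : Fin n → ℕ) (i : Fin n) :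
    ∑ j, (m + (Pi.single i 1 : Fin n → ℕ)) j = ∑ j, m j + 1 := by
  simp [Finset.sum_add_distrib]

theorem shift_mem {n t : ℕ} (m : Fin n → ℕ) (i : Fin n) :
    m + Pi.single i 1 ∈ degMon n (t+1) ↔ m ∈ degMon n t := by
  rw [mem_degMon, mem_degMon, sum_single]; omega

theorem exists_sub {n : ℕ} (m : Fin n → ℕ) (i : Fin n) (h : 0 < m i) :
    ∃ m' : Fin n → ℕ, m = m' + (Pi.single i 1 : Fin n → ℕ) := by
  refine ⟨m - Pi.single i 1, ?_⟩
  funext j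
  by_cases hj : j = i
  · subst hj; simp; omega
  · simp [hj]

theorem isLexSeg_shift {n t : ℕ} {L : Finset (Fin (n+1) → ℕ)}
    (h : IsLexSeg (degMon (n+1) t) L) :
    IsLexSeg (degMon (n+1) (t+1)) (L.image (· + Pi.single 0 1)) := by
  refine ⟨?_, ?_⟩
  · intro v hv
    rw [mem_image] at hv
    obtain ⟨m, hm, rfl⟩ := hv
    exact (shift_mem m 0).2 (h.1 hm)
  · intro w hw v hv hwv
    rw [mem_image] at hw
    obtain ⟨m, hm, rfl⟩ := hw
    have hv0 : 0 < v 0 := by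
      obtain ⟨i, h1, h2⟩ := hwv
      by_cases hi : i = 0
      · subst hi; exact lt_of_le_of_lt (Nat.zero_le _) h2
      · have := h1 0 (Fin.pos_of_ne_zero hi)
        rw [← this]; simp
    obtain ⟨v', rfl⟩ := exists_sub v 0 hv0
    rw [lexLt_add] at hwv
    exact mem_image_of_mem _ (h.2 m hm v' ((shift_mem v' 0).1 hv) hwv)

def gg (n t d : ℕ) : ℕ := (S1mul n (lexSeg (degMon n t) d)).card

theorem card_degMon_le (n t : ℕ) : (degMon (n+1) t).card ≤ (degMon (n+1) (t+1)).card := by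
  rw [← card_shift (degMon (n+1) t) (Pi.single 0 1)]
  apply card_le_card
  intro v hv
  rw [mem_image] at hv
  obtain ⟨m, hm, rfl⟩ := hv
  exact (shift_mem m 0).2 hm

theorem degMon_mono (n : ℕ) : Monotone (fun t => (degMon (n+1) t).card) :=
  monotone_nat_of_le_succ (card_degMon_le n)

theorem gg_succ (n t d : ℕ) (hd : d ≤ (degMon (n+1) t).card) :
    gg (n+1) (t+1) d = gg (n+1) t d := by
  have h := isLexSeg_shift (isLexSeg_lexSeg (degMon (n+1) t) d)
  have h2 := lexSeg_of_isLexSeg h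
  rw [card_shift, card_lexSeg _ _ hd] at h2
  rw [gg, h2, S1mul_shift, card_shift, gg]

theorem gg_add (n t d s : ℕ) (hd : d ≤ (degMon (n+1) t).card) :
    gg (n+1) (t+s) d = gg (n+1) t d := by
  induction s with
  | zero => rfl
  | succ s ih =>
    rw [← add_assoc, gg_succ, ih]
    exact hd.trans (degMon_mono n (by omega))

theorem gg_eq (n t t' d : ℕ) (hd : d ≤ (degMon (n+1) t).card)
    (hd' : d ≤ (degMon (n+1) t').card) : gg (n+1) t d = gg (n+1) t' d := by
  rw [← gg_add n t d t' hd, ← gg_add n t' d t hd', add_comm t t']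

theorem degMon_zero (n : ℕ) : degMon n 0 = {0} := by
  ext m
  rw [mem_degMon, mem_singleton]
  simp [funext_iff]

theorem card_degMon_pos (n t : ℕ) : 1 ≤ (degMon (n+1) t).card := by
  have := degMon_mono n (Nat.zero_le t)
  simpa [degMon_zero] using this

theorem Bset_one (n t : ℕ) :
    Bset (n+1) 1 (t+1) = (degMon (n+1) t).image (· + Pi.single 0 1) := by
  ext v
  simp only [Bset, mem_filter, x1exp_succ, mem_image]
  constructor
  · rintro ⟨h1, h2⟩
    obtain ⟨v', rfl⟩ := exists_sub v 0 h2
    exact ⟨v', (shift_mem v' 0).1 h1, rfl⟩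
  · rintro ⟨m, hm, rfl⟩
    exact ⟨(shift_mem m 0).2 hm, by simp⟩

theorem consZ_inj (n : ℕ) : Function.Injective (fun m : Fin n → ℕ => (Fin.cons 0 m : Fin (n+1) → ℕ)) :=
  fun a b h => (Fin.cons_injective2 h).2

theorem RMon_one (n t : ℕ) :
    RMon (n+1) 1 t = (degMon n t).image (fun m => (Fin.cons 0 m : Fin (n+1) → ℕ)) := by
  ext v
  simp only [RMon, mem_filter, x1exp_succ, mem_image, mem_degMon]
  constructor
  · rintro ⟨h1, h2⟩
    rw [Fin.sum_univ_succ] at h1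
    have h3 : v 0 = 0 := by omega
    refine ⟨fun i => v i.succ, by simp only; omega, ?_⟩
    rw [← h3]; exact Fin.cons_self_tail v
  · rintro ⟨m, hm, rfl⟩
    rw [Fin.sum_univ_succ]
    simp [hm]

theorem card_B_add_R (n a t : ℕ) :
    (Bset n a t).card + (RMon n a t).card = (degMon n t).card := by
  rw [← card_filter_add_card_filter_not (s := degMon n t) (fun m => a ≤ x1exp m)]
  simp only [Bset, RMon, not_le]

theorem card_degMon_succ (n t : ℕ) :
    (degMon (n+1) (t+1)).card = (degMon (n+1) t).card + (degMon n (t+1)).card := by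
  rw [← card_B_add_R _ 1, Bset_one, card_shift, RMon_one,
    card_image_of_injective _ (consZ_inj n)]

theorem le_card_degMon (n d : ℕ) : d + 1 ≤ (degMon (n+2) d).card := by
  induction d with
  | zero => exact card_degMon_pos _ _
  | succ d ih =>
    have h := card_degMon_succ (n+1) d
    have := card_degMon_pos n (d+1)
    change _ = (degMon (n+2) d).card + _ at h
    change _ ≤ (degMon (n+1+1) (d+1)).card
    omega

theorem growth_eq (n t d : ℕ) (hd : d ≤ (degMon (n+2) t).card) :
    growth d (n+1) = gg (n+2) t d :=
  gg_eq (n+1) d t d ((Nat.le_succ d).trans (le_card_degMon n d)) hd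

theorem isLexSeg_B (n a t : ℕ) : IsLexSeg (degMon (n+1) t) (Bset (n+1) a t) := by
  refine ⟨filter_subset _ _, ?_⟩
  intro m hm v hv hmv
  simp only [Bset, mem_filter, x1exp_succ] at hm ⊢
  refine ⟨hv, le_trans hm.2 ?_⟩
  obtain ⟨i, h1, h2⟩ := hmv
  by_cases hi : i = 0
  · subst hi; exact h2.le
  · exact (h1 0 (Fin.pos_of_ne_zero hi)).le

theorem isLexSeg_BL (n a t : ℕ) {L : Finset (Fin (n+1) → ℕ)} (hL : IsLexSeg (RMon (n+1) a t) L) :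
    IsLexSeg (degMon (n+1) t) (Bset (n+1) a t ∪ L) := by
  refine ⟨union_subset (filter_subset _ _) (hL.1.trans (filter_subset _ _)), ?_⟩
  intro m hm v hv hmv
  rw [mem_union] at hm ⊢
  rcases hm with hm | hm
  · exact Or.inl ((isLexSeg_B n a t).2 m hm v hv hmv)
  · by_cases h : a ≤ x1exp v
    · exact Or.inl (mem_filter.2 ⟨hv, h⟩)
    · exact Or.inr (hL.2 m hm v (mem_filter.2 ⟨hv, by omega⟩) hmv)

theorem S1mul_B_filter (n a t : ℕ) (hta : a ≤ t) {L : Finset (Fin (n+1) → ℕ)}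
    (hL : L ⊆ RMon (n+1) a t) :
    (S1mul (n+1) (Bset (n+1) a t ∪ L)).filter (fun m => a ≤ x1exp m)
      = S1mul (n+1) (Bset (n+1) a t) := by
  ext v
  simp only [mem_filter, mem_S1mul, mem_union, x1exp_succ]
  constructor
  · rintro ⟨⟨i, m, hm | hm, rfl⟩, h⟩
    · exact ⟨i, m, hm, rfl⟩
    · have hm' := hL hm
      simp only [RMon, mem_filter, x1exp_succ, mem_degMon] at hm'
      obtain ⟨h1, h2⟩ := hm'
      have hi : i = 0 := by
        by_contra hi
        have : (Pi.single i 1 : Fin (n+1) → ℕ) 0 = 0 := Pi.single_eq_of_ne (Ne.symm hi) 1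
        simp only [Pi.add_apply, this] at h
        omega
      subst hi
      have : ∃ j : Fin n, 0 < m j.succ := by
        by_contra hc
        push Not at hc
        rw [Fin.sum_univ_succ, Finset.sum_eq_zero (fun j _ => Nat.le_zero.1 (hc j))] at h1
        omega
      obtain ⟨j, hj⟩ := this
      obtain ⟨m', rfl⟩ := exists_sub m j.succ hj
      refine ⟨j.succ, m' + Pi.single 0 1, ?_, by abel⟩
      simp only [Bset, mem_filter, x1exp_succ, mem_degMon]
      rw [sum_single] at h1 ⊢
      refine ⟨h1, ?_⟩
      have e : (Pi.single j.succ 1 : Fin (n+1) → ℕ) 0 = 0 :=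
        Pi.single_eq_of_ne (Fin.succ_ne_zero j).symm 1
      simp only [Pi.add_apply, e] at h ⊢
      omega
  · rintro ⟨i, m, hm, rfl⟩
    refine ⟨⟨i, m, Or.inl hm, rfl⟩, ?_⟩
    simp only [Bset, mem_filter, x1exp_succ] at hm
    exact hm.2.trans (by simp)

theorem S1mul_B_filter' (n a t : ℕ) (L : Finset (Fin (n+1) → ℕ)) :
    (S1mul (n+1) (Bset (n+1) a t ∪ L)).filter (fun m => ¬ a ≤ x1exp m)
      = R1mul (n+1) a L := by
  ext v
  simp only [R1mul, mem_filter, mem_S1mul, mem_union, not_le]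
  constructor
  · rintro ⟨⟨i, m, hm | hm, rfl⟩, h⟩
    · exfalso
      simp only [Bset, mem_filter, x1exp_succ] at hm
      simp only [x1exp_succ, Pi.add_apply] at h
      omega
    · exact ⟨⟨i, m, hm, rfl⟩, h⟩
  · rintro ⟨⟨i, m, hm, rfl⟩, h⟩
    exact ⟨⟨i, m, Or.inr hm, rfl⟩, h⟩

theorem dnt_add (n a t d : ℕ) (hta : a ≤ t) (hd : d ≤ (RMon (n+2) a t).card) :
    growth (d + (Bset (n+2) a t).card) (n+1)
      = growth (Bset (n+2) a t).card (n+1) + dnt (n+2) a t d := by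
  have hBR := card_B_add_R (n+2) a t
  rw [growth_eq n t _ (by omega), growth_eq n t _ (by omega)]
  have hL := isLexSeg_lexSeg (RMon (n+2) a t) d
  have hLc := card_lexSeg (RMon (n+2) a t) d hd
  rw [gg, gg, lexSeg_of_isLexSeg (isLexSeg_B (n+1) a t)]
  have hdis : Disjoint (Bset (n+2) a t) (lexSeg (RMon (n+2) a t) d) := by
    rw [disjoint_left]
    intro m h1 h2
    have h2 := hL.1 h2
    simp only [Bset, RMon, mem_filter] at h1 h2
    omega
  have e : d + (Bset (n+2) a t).card
      = (Bset (n+2) a t ∪ lexSeg (RMon (n+2) a t) d).card := by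
    rw [card_union_of_disjoint hdis, hLc, add_comm]
  rw [e, lexSeg_of_isLexSeg (isLexSeg_BL (n+1) a t hL),
    ← card_filter_add_card_filter_not (fun m => a ≤ x1exp m),
    S1mul_B_filter (n+1) a t hta hL.1, S1mul_B_filter' (n+1) a t, dnt]

theorem lexLt_cons {n : ℕ} (u v : Fin n → ℕ) :
    lexLt (Fin.cons 0 u : Fin (n+1) → ℕ) (Fin.cons 0 v) ↔ lexLt u v := by
  constructor
  · rintro ⟨i, h1, h2⟩
    induction i using Fin.cases with
    | zero => simp at h2
    | succ i =>
      refine ⟨i, fun j hj => ?_, by simpa using h2⟩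
      simpa using h1 j.succ (by simpa using hj)
  · rintro ⟨i, h1, h2⟩
    refine ⟨i.succ, fun j hj => ?_, by simpa using h2⟩
    induction j using Fin.cases with
    | zero => simp
    | succ j => simpa using h1 j (by simpa using hj)

theorem cons_add_single {n : ℕ} (m : Fin n → ℕ) (i : Fin n) :
    (Fin.cons 0 m : Fin (n+1) → ℕ) + Pi.single i.succ 1 = Fin.cons 0 (m + Pi.single i 1) := by
  funext j
  induction j using Fin.cases with
  | zero => simp [Pi.single_eq_of_ne (Fin.succ_ne_zero i).symm]
  | succ j => simp [Pi.single_apply]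

theorem dnt_one (n t d : ℕ) (hd : d ≤ (degMon n t).card) : dnt (n+1) 1 t d = gg n t d := by
  have hL := isLexSeg_lexSeg (degMon n t) d
  have hLc := card_lexSeg (degMon n t) d hd
  set L := lexSeg (degMon n t) d with hLdef
  have h1 : IsLexSeg (RMon (n+1) 1 t) (L.image (fun m => (Fin.cons 0 m : Fin (n+1) → ℕ))) := by
    rw [RMon_one]
    refine ⟨image_subset_image hL.1, ?_⟩
    intro m hm v hv hmv
    rw [mem_image] at hm hv
    obtain ⟨m, hm, rfl⟩ := hm
    obtain ⟨v, hv, rfl⟩ := hv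
    rw [lexLt_cons] at hmv
    exact mem_image_of_mem _ (hL.2 m hm v hv hmv)
  have h2 := lexSeg_of_isLexSeg h1
  rw [card_image_of_injective _ (consZ_inj n), hLc] at h2
  rw [dnt, h2, gg, ← hLdef, ← card_image_of_injective (S1mul n L) (consZ_inj n)]
  congr 1
  ext v
  simp only [R1mul, mem_filter, mem_S1mul, mem_image, x1exp_succ]
  constructor
  · rintro ⟨⟨i, _, ⟨m, hm, rfl⟩, rfl⟩, h⟩
    induction i using Fin.cases with
    | zero => simp at h
    | succ i => exact ⟨_, ⟨i, m, hm, rfl⟩, (cons_add_single m i).symm⟩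
  · rintro ⟨_, ⟨i, m, hm, rfl⟩, rfl⟩
    refine ⟨⟨i.succ, _, ⟨m, hm, rfl⟩, cons_add_single m i⟩, by simp⟩

theorem growth_zero (k : ℕ) : growth 0 k = 0 := by
  rw [growth, lexSeg_zero, card_eq_zero, eq_empty_iff_forall_notMem]
  intro v hv
  rw [mem_S1mul] at hv
  simp at hv

theorem growth_one (k : ℕ) : growth 1 k = k + 1 := by
  have h : growth 1 k = gg (k+1) 0 1 :=
    gg_eq k 1 0 1 (card_degMon_pos _ _) (card_degMon_pos _ _)
  rw [h, gg]
  have h1 : lexSeg (degMon (k+1) 0) 1 = {0} := by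
    have := card_lexSeg (degMon (k+1) 0) 1 (card_degMon_pos _ _)
    have h2 : lexSeg (degMon (k+1) 0) 1 ⊆ {0} := by
      rw [← degMon_zero]; exact filter_subset _ _
    exact eq_of_subset_of_card_le h2 (by simp [this])
  rw [h1]
  have : S1mul (k+1) {0} = univ.image (fun i : Fin (k+1) => (Pi.single i 1 : Fin (k+1) → ℕ)) := by
    ext v; simp [mem_S1mul]
  rw [this, card_image_of_injective]
  · simp
  · intro i j hij
    by_contra hne
    have := congrFun hij i
    simp [hne] at this

theorem degMon_one (t : ℕ) : degMon 1 t = {fun _ => t} := by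
  ext m
  rw [mem_degMon, mem_singleton]
  simp [funext_iff, Fin.forall_fin_one]

theorem growth_k0 (d : ℕ) : growth d 0 = min d 1 := by
  rcases Nat.eq_zero_or_pos d with rfl | h
  · rw [growth_zero]; rfl
  · have h1 : lexSeg (degMon (0+1) d) d = degMon 1 d := by
      refine filter_true_of_mem fun m _ => ?_
      refine (card_filter_le _ _).trans ?_
      simp [degMon_one]; omega
    rw [growth, h1, degMon_one]
    simp [S1mul]
    omega

/-- the recursion -/
theorem growth_rec (k i r : ℕ) (hr : r ≤ (degMon (k+1) (i+1)).card) :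
    growth ((degMon (k+2) i).card + r) (k+1)
      = growth (degMon (k+2) i).card (k+1) + gg (k+1) (i+1) r := by
  have hR : (RMon (k+2) 1 (i+1)).card = (degMon (k+1) (i+1)).card := by
    rw [RMon_one, card_image_of_injective _ (consZ_inj _)]
  have hB : (Bset (k+2) 1 (i+1)).card = (degMon (k+2) i).card := by
    rw [Bset_one, card_shift]
  have := dnt_add k 1 (i+1) r (by omega) (by omega)
  rw [hB, dnt_one _ _ _ hr] at this
  rw [add_comm _ r, this]

theorem gg_growth (k t r : ℕ) (hr : r ≤ (degMon (k+1) t).card) :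
    gg (k+1) t r = growth r k := by
  cases k with
  | succ k => exact (growth_eq k t r hr).symm
  | zero =>
    refine gg_eq 0 t r r hr ?_
    simpa [degMon_one] using hr

theorem growth_ab (k : ℕ) :
    (∀ x q, growth (x+q) k ≤ growth x k + growth q k) ∧
    (∀ j u q x, u + q = (degMon (k+1) j).card → x + q ≤ (degMon (k+1) j).card →
      growth (degMon (k+1) j).card k + growth x k ≤ growth (x+q) k + growth u k) ∧
    (∀ x q, 0 < x → 0 < q → growth (x+q) (k+1) < growth x (k+1) + growth q (k+1)) := by
  have key : ∀ k, (∀ x q, growth (x+q) k ≤ growth x k + growth q k) →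
    (∀ j u q x, u + q = (degMon (k+1) j).card → x + q ≤ (degMon (k+1) j).card →
      growth (degMon (k+1) j).card k + growth x k ≤ growth (x+q) k + growth u k) →
    ((∀ x q, 0 < x → 0 < q → growth (x+q) (k+1) < growth x (k+1) + growth q (k+1)) ∧
    (∀ j u q x, u + q = (degMon (k+2) j).card → x + q ≤ (degMon (k+2) j).card →
      growth (degMon (k+2) j).card (k+1) + growth x (k+1)
        ≤ growth (x+q) (k+1) + growth u (k+1))) := by
    intro k ha hb
    have hF : ∀ i r, r ≤ (degMon (k+1) (i+1)).card →
      growth ((degMon (k+2) i).card + r) (k+1)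
        = growth (degMon (k+2) i).card (k+1) + growth r k := by
      intro i r hr
      rw [growth_rec k i r hr, gg_growth k _ r hr]
    refine ⟨?_, ?_⟩
    · exact num_L5 (fun d => growth d k) (fun d => growth d (k+1))
        (fun i => (degMon (k+1) i).card) (fun i => (degMon (k+2) i).card)
        (card_degMon_pos k) (degMon_mono k) (by simp [degMon_zero])
        (fun i => card_degMon_succ (k+1) i) (growth_zero _)
        (by simp only [growth_one]) (growth_zero _) hF ha hb
    · exact num_L4 (fun d => growth d k) (fun d => growth d (k+1))
        (fun i => (degMon (k+1) i).card) (fun i => (degMon (k+2) i).card)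
        (card_degMon_pos k) (degMon_mono k) (by simp [degMon_zero])
        (fun i => card_degMon_succ (k+1) i) (growth_zero _)
        (by simp only [growth_one]) (growth_zero _) hF ha hb
  induction k with
  | zero =>
    have ha : ∀ x q, growth (x+q) 0 ≤ growth x 0 + growth q 0 := by
      intro x q
      simp only [growth_k0]; omega
    have hb : ∀ j u q x, u + q = (degMon (0+1) j).card → x + q ≤ (degMon (0+1) j).card →
      growth (degMon (0+1) j).card 0 + growth x 0 ≤ growth (x+q) 0 + growth u 0 := by
      intro j u q x
      simp only [growth_k0, zero_add, degMon_one, card_singleton]; omega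
    exact ⟨ha, hb, (key 0 ha hb).1⟩
  | succ k ih =>
    obtain ⟨ha, hb, hc⟩ := ih
    have h2 := (key k ha hb).2
    have ha' : ∀ x q, growth (x+q) (k+1) ≤ growth x (k+1) + growth q (k+1) := by
      intro x q
      rcases Nat.eq_zero_or_pos x with rfl | hx
      · rw [zero_add]; omega
      rcases Nat.eq_zero_or_pos q with rfl | hq
      · rw [add_zero]; omega
      exact (hc x q hx hq).le
    exact ⟨ha', h2, (key (k+1) ha' h2).1⟩

/-- For `t ≥ a`, with `B` the set of degree-`t` monomials divisible by
`x_1^a` and `d` smaller than the number of monomials in `R_t`,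
`d_{n,t} = (d + |B|)^{<n-1>} - |B|^{<n-1>}`; in particular `d_{n,t} < d^{<n-1>}`. -/
theorem stmt_3 (n a t d : ℕ) (ha : 1 ≤ a) (hta : a ≤ t) (hd0 : 0 < d)
    (hd : d < (RMon n a t).card) :
    dnt n a t d =
        growth (d + (Bset n a t).card) (n - 1) - growth ((Bset n a t).card) (n - 1) ∧
      dnt n a t d < growth d (n - 1) := by
  match n, hd with
  | 0, hd =>
    exfalso
    have h : RMon 0 a t = ∅ := by
      refine filter_eq_empty_iff.2 fun m hm => ?_
      rw [mem_degMon] at hm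
      simp at hm
      omega
    rw [h] at hd
    simp at hd
  | 1, hd =>
    exfalso
    have h : RMon 1 a t = ∅ := by
      refine filter_eq_empty_iff.2 fun m hm => ?_
      rw [degMon_one, mem_singleton] at hm
      subst hm
      rw [x1exp_succ]
      omega
    rw [h] at hd
    simp at hd
  | n+2, hd =>
    have h1 := dnt_add n a t d hta hd.le
    have hB : 0 < (Bset (n+2) a t).card := by
      rw [card_pos]
      refine ⟨Pi.single 0 t, ?_⟩
      simp only [Bset, mem_filter, mem_degMon, x1exp_succ]
      simp [hta]
    have h2 := (growth_ab n).2.2 d (Bset (n+2) a t).card hd0 hB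
    have e : n + 2 - 1 = n + 1 := rfl
    rw [e]
    omega
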